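/- (Interaction Morawetz identity for the cubic GP hierarchy.) Let (γ^{(k)})_{k≥1} be a solution of the cubic Gross–Pitaevskii hierarchy on ℝᵈ as in the setup, let a : ℝᵈ × ℝᵈ → ℝ be smooth with all derivatives of at most polynomial growth, define P_x(t,x,y) = (1/(2i)) (∇_x − ∇_{x'}) γ^{(2)}(t,x,y;x',y') |_{x'=x, y'=y} and the interaction Morawetz action M_a(t) = ∫∫ ∇_x a(x,y) · P_x(t,x,y) dx dy. Then for every t, d/dt M_a(t) = −(1/2) ∫∫ (Δ_x a(x,y)) Δ_x[ γ^{(2)}(t,x,y;x,y) ] dx dy + (λ/2) ∫∫ (Δ_x a(x,y)) γ^{(3)}(t,x,y,x;x,y,x) dx dy + 2 Re ∫∫ Σ_{j,ℓ} (∂_{x_j}∂_{x_ℓ} a(x,y)) [ ∂_{x_ℓ} ∂_{x'_j} γ^{(2)}(t,x,y;x',y) ] |_{x'=x} dx dy + 2 ∫∫ Σ_{j,ℓ} (∂_{x_j}∂_{y_ℓ} a(x,y)) Q_{jℓ}(t,x,y) dx dy, where Δ_x[γ^{(2)}(t,x,y;x,y)] denotes the Laplacian in x of the diagonal function (x,y)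 ↦ γ^{(2)}(t,x,y;x,y), and Q_{jℓ}(t,x,y) = [ −(1/4) (∂_{x_j} − ∂_{x'_j})(∂_{y_ℓ} − ∂_{y'_ℓ}) γ^{(2)}(t,x,y;x',y') ] |_{x'=x, y'=y}. -/

import Mathlib

open MeasureTheory Complex

noncomputable section

/-- Euclidean space `ℝᵈ`. -/
abbrev Ed (d : ℕ) := EuclideanSpace ℝ (Fin d)

/-- Laplacian `Δ_{x_j}` acting in the `j`-th particle variable of a function of
`k` particle variables. -/
noncomputable def lapAt {d k : ℕ} (j : Fin k) (f : (Fin k → Ed d) → ℂ)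
    (x : Fin k → Ed d) : ℂ :=
  ∑ ℓ : Fin d,
    fderiv ℝ (fun z => fderiv ℝ f z (Pi.single j (EuclideanSpace.single ℓ 1))) x
      (Pi.single j (EuclideanSpace.single ℓ 1))

/-- The collision operator `B_{k+1}` of the cubic GP hierarchy:
`(B_{k+1}γ^{(k+1)})(x⃗;x⃗') = Σ_j [γ^{(k+1)}(x⃗,x_j;x⃗',x_j) − γ^{(k+1)}(x⃗,x'_j;x⃗',x'_j)]`. -/
noncomputable def Bcoll {d k : ℕ}
    (g : (Fin (k + 1) → Ed d) → (Fin (k + 1) → Ed d) → ℂ)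
    (x x' : Fin k → Ed d) : ℂ :=
  ∑ j : Fin k,
    (g (Fin.snoc x (x j)) (Fin.snoc x' (x j))
      - g (Fin.snoc x (x' j)) (Fin.snoc x' (x' j)))

/-- A Schwartz-class solution of the cubic Gross–Pitaevskii hierarchy on `ℝᵈ` with
coupling `λ`: smooth, Schwartz in the space variables locally uniformly in `t`,
hermitean, symmetric, admissible, and solving
`i∂ₜγ^{(k)} = −Σ_j (Δ_{x_j} − Δ_{x'_j})γ^{(k)} + λ B_{k+1}γ^{(k+1)}`. -/
structure GPSolution (d : ℕ) (lam : ℝ)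
    (γ : (k : ℕ) → ℝ → (Fin k → Ed d) → (Fin k → Ed d) → ℂ) : Prop where
  smooth : ∀ k, ContDiff ℝ (⊤ : ℕ∞)
      (fun q : ℝ × (Fin k → Ed d) × (Fin k → Ed d) => γ k q.1 q.2.1 q.2.2)
  decay : ∀ (k m N : ℕ) (T : ℝ), ∃ C : ℝ, ∀ t : ℝ, |t| ≤ T →
      ∀ q : (Fin k → Ed d) × (Fin k → Ed d),
        (1 + ‖q‖) ^ N *
            ‖iteratedFDeriv ℝ m
              (fun r : (Fin k → Ed d) × (Fin k → Ed d) => γ k t r.1 r.2) q‖ ≤ C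
  hermitian : ∀ k t x x', γ k t x x' = starRingEnd ℂ (γ k t x' x)
  symm : ∀ k t (σ : Equiv.Perm (Fin k)) x x', γ k t (x ∘ σ) (x' ∘ σ) = γ k t x x'
  admissible : ∀ k t x x',
      γ k t x x' = ∫ y : Ed d, γ (k + 1) t (Fin.snoc x y) (Fin.snoc x' y)
  eq : ∀ k t x x',
      Complex.I * deriv (fun s => γ k s x x') t
        = -(∑ j : Fin k, (lapAt j (fun z => γ k t z x') x - lapAt j (γ k t x) x'))
          + lam * Bcoll (γ (k + 1) t) x x'

/-- The one-particle configuration `(x)` as an element of `Fin 1 → ℝᵈ`. -/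
def onePt {d : ℕ} (x : Ed d) : Fin 1 → Ed d := fun _ => x

/-- The momentum density
`P_ℓ(x) = (1/(2i))(∂_{x_ℓ} − ∂_{x'_ℓ})γ^{(1)}(x;x')|_{x'=x}` associated with a
one-particle kernel `γ¹`. -/
noncomputable def Pmom {d : ℕ}
    (γ1 : (Fin 1 → Ed d) → (Fin 1 → Ed d) → ℂ) (ℓ : Fin d) (x : Ed d) : ℂ :=
  (1 / (2 * Complex.I)) *
    (fderiv ℝ (fun z => γ1 (onePt z) (onePt x)) x (EuclideanSpace.single ℓ 1)
      - fderiv ℝ (fun z => γ1 (onePt x) (onePt z)) x (EuclideanSpace.single ℓ 1))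

/-- Partial derivative `∂_{x_j} f` of a real-valued function on `ℝᵈ`. -/
noncomputable def rpdE {d : ℕ} (j : Fin d) (f : Ed d → ℝ) (x : Ed d) : ℝ :=
  fderiv ℝ f x (EuclideanSpace.single j 1)

/-- Laplacian of a real-valued function on `ℝᵈ`. -/
noncomputable def rlapE {d : ℕ} (f : Ed d → ℝ) (x : Ed d) : ℝ := ∑ j, rpdE j (rpdE j f) x

/-- Partial derivative `∂_{x_j}` of a real-valued function on `ℝᵈ × ℝᵈ`
(derivative in the first factor). -/
noncomputable def pdx {d : ℕ} (j : Fin d) (f : Ed d × Ed d → ℝ) (q : Ed d × Ed d) : ℝ :=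
  fderiv ℝ f q (EuclideanSpace.single j 1, 0)

/-- Partial derivative `∂_{y_ℓ}` of a real-valued function on `ℝᵈ × ℝᵈ`
(derivative in the second factor). -/
noncomputable def pdy {d : ℕ} (ℓ : Fin d) (f : Ed d × Ed d → ℝ) (q : Ed d × Ed d) : ℝ :=
  fderiv ℝ f q (0, EuclideanSpace.single ℓ 1)

/-- Laplacian `Δ_x` in the first factor of a real-valued function on `ℝᵈ × ℝᵈ`. -/
noncomputable def lapX {d : ℕ} (f : Ed d × Ed d → ℝ) (q : Ed d × Ed d) : ℝ :=
  ∑ j, pdx j (pdx j f) q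

/-- The momentum density in the first particle variable,
`(P_x)_ℓ(x,y) = (1/(2i))(∂_{x_ℓ} − ∂_{x'_ℓ})γ^{(2)}(x,y;x',y')|_{x'=x,y'=y}`. -/
noncomputable def Pmom2 {d : ℕ}
    (γ2 : (Fin 2 → Ed d) → (Fin 2 → Ed d) → ℂ) (ℓ : Fin d) (x y : Ed d) : ℂ :=
  (1 / (2 * Complex.I)) *
    (fderiv ℝ (fun z => γ2 ![z, y] ![x, y]) x (EuclideanSpace.single ℓ 1)
      - fderiv ℝ (fun z => γ2 ![x, y] ![z, y]) x (EuclideanSpace.single ℓ 1))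

/-- The momentum correlation kernel
`Q_{jℓ}(x,y) = [−(1/4)(∂_{x_j}−∂_{x'_j})(∂_{y_ℓ}−∂_{y'_ℓ})γ^{(2)}(x,y;x',y')]|_{x'=x,y'=y}`. -/
noncomputable def Qcorr {d : ℕ}
    (γ2 : (Fin 2 → Ed d) → (Fin 2 → Ed d) → ℂ) (j ℓ : Fin d) (x y : Ed d) : ℂ :=
  (-(1 / 4) : ℂ) *
    (fderiv ℝ (fun w => fderiv ℝ (fun z => γ2 ![z, w] ![x, y]) x
        (EuclideanSpace.single j 1)) y (EuclideanSpace.single ℓ 1)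
      - fderiv ℝ (fun w => fderiv ℝ (fun z => γ2 ![z, y] ![x, w]) x
          (EuclideanSpace.single j 1)) y (EuclideanSpace.single ℓ 1)
      - fderiv ℝ (fun w => fderiv ℝ (fun z => γ2 ![x, w] ![z, y]) x
          (EuclideanSpace.single j 1)) y (EuclideanSpace.single ℓ 1)
      + fderiv ℝ (fun w => fderiv ℝ (fun z => γ2 ![x, y] ![z, w]) x
          (EuclideanSpace.single j 1)) y (EuclideanSpace.single ℓ 1))


/-! ### General calculus tools -/

section Gen

set_option linter.unusedSectionVars false

variable {X Y : Type*} [NormedAddCommGroup X] [NormedSpace ℝ X]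
  [NormedAddCommGroup Y] [NormedSpace ℝ Y]
  {F : Type*} [NormedAddCommGroup F] [NormedSpace ℝ F]

/-- Directional derivative. -/
def DD (v : X) (f : X → F) : X → F := fun w => fderiv ℝ f w v

abbrev Sm (f : X → F) : Prop := ContDiff ℝ (⊤ : ℕ∞) f

lemma Sm.diff {f : X → F} (hf : Sm f) : Differentiable ℝ f :=
  ContDiff.differentiable hf (by simp)

lemma Sm.fderiv' {f : X → F} (hf : Sm f) : Sm (fderiv ℝ f) :=
  ContDiff.fderiv_right hf (by simp)

lemma Sm.DD {f : X → F} (hf : Sm f) (v : X) : Sm (DD v f) :=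
  ContDiff.clm_apply (hf.fderiv') contDiff_const

lemma DD_add_dir (u v : X) (f : X → F) : DD (u + v) f = DD u f + DD v f := by
  funext w; simp [DD]

lemma DD_sub_dir (u v : X) (f : X → F) : DD (u - v) f = DD u f - DD v f := by
  funext w; simp [DD]

lemma DD_add {f g : X → F} (hf : Sm f) (hg : Sm g) (v : X) :
    DD v (f + g) = DD v f + DD v g := by
  funext w; simp only [DD, Pi.add_apply]
  rw [fderiv_add (hf.diff w) (hg.diff w)]; simp

lemma DD_sub {f g : X → F} (hf : Sm f) (hg : Sm g) (v : X) :
    DD v (f - g) = DD v f - DD v g := by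
  funext w; simp only [DD, Pi.sub_apply]
  rw [fderiv_sub (hf.diff w) (hg.diff w)]; simp

lemma DD_comm {f : X → F} (hf : Sm f) (u v : X) : DD u (DD v f) = DD v (DD u f) := by
  funext w
  have h1 : ∀ a b : X, DD a (DD b f) w = fderiv ℝ (fderiv ℝ f) w a b := by
    intro a b
    have := fderiv_clm_apply (hf.fderiv'.diff w) (differentiableAt_const b)
    change fderiv ℝ (fun y => fderiv ℝ f y b) w a = _
    rw [this]
    simp
  rw [h1, h1]
  exact (ContDiffAt.isSymmSndFDerivAt (hf.contDiffAt) (by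
    simp only [minSmoothness_of_isRCLikeNormedField]
    exact WithTop.coe_le_coe.2 (le_top : (2 : ℕ∞) ≤ ⊤))) u v

lemma DD_sq_sub {f : X → F} (hf : Sm f) (u v : X) :
    DD u (DD u f) - DD v (DD v f) = DD (u + v) (DD (u - v) f) := by
  rw [DD_sub_dir, DD_sub (hf.DD u) (hf.DD v), DD_add_dir, DD_add_dir, DD_comm hf v u]
  abel

lemma DD_comp {f : Y → F} (hf : Differentiable ℝ f) (c : Y) (L : X →L[ℝ] Y) (v : X) :
    DD v (fun z => f (c + L z)) = fun z => DD (L v) f (c + L z) := by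
  funext z
  have h : HasFDerivAt (fun z => c + L z) L z := L.hasFDerivAt.const_add c
  have := (hf (c + L z)).hasFDerivAt.comp z h
  simp only [DD]
  erw [this.fderiv]
  rfl

lemma DD_comp0 {f : Y → F} (hf : Differentiable ℝ f) (L : X →L[ℝ] Y) (v : X) :
    DD v (fun z => f (L z)) = fun z => DD (L v) f (L z) := by
  simpa using DD_comp hf 0 L v

lemma DD_sum {ι : Type*} (S : Finset ι) {f : ι → X → F} (hf : ∀ i, Sm (f i)) (v : X) :
    DD v (fun w => ∑ i ∈ S, f i w) = fun w => ∑ i ∈ S, DD v (f i) w := by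
  funext w; simp only [DD]
  rw [fderiv_fun_sum (fun i _ => (hf i).diff w)]; simp

lemma DD_cmul {f : X → ℂ} (hf : Sm f) (c : ℂ) (v : X) :
    DD v (fun w => c * f w) = fun w => c * DD v f w := by
  funext w; simp only [DD]
  rw [fderiv_const_mul (hf.diff w)]; simp

lemma fd_slot {f : Y → F} (hf : Sm f) {p : X → Y} (L : X →L[ℝ] Y)
    (hp : ∀ z, p z = p 0 + L z) (x e : X) :
    fderiv ℝ (fun z => f (p z)) x e = DD (L e) f (p x) := by
  have : (fun z => f (p z)) = fun z => f (p 0 + L z) := by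
    funext z; rw [hp z]
  rw [this]
  have h2 := congrFun (DD_comp hf.diff (p 0) L e) x
  rw [← hp x] at h2
  exact h2

/-- Commuting a parameter derivative with a space derivative. -/
lemma param_deriv {Φ : ℝ × X → ℂ} (hΦ : Sm Φ) (v : X) (s : ℝ) (w : X) :
    HasDerivAt (fun s => DD v (fun w => Φ (s, w)) w)
      (DD v (fun w => deriv (fun s => Φ (s, w)) s) w) s := by
  have h0 : ∀ {Ψ : ℝ × X → ℂ}, Sm Ψ → ∀ s w,
      HasDerivAt (fun s => Ψ (s, w)) (DD ((1 : ℝ), (0 : X)) Ψ (s, w)) s := by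
    intro Ψ hΨ s w
    have h1 : HasDerivAt (fun s : ℝ => (s, w)) ((1 : ℝ), (0 : X)) s :=
      (hasDerivAt_id s).prodMk (hasDerivAt_const s w)
    exact (hΨ.diff (s, w)).hasFDerivAt.comp_hasDerivAt s h1
  have h1 : ∀ {Ψ : ℝ × X → ℂ}, Sm Ψ → ∀ s w,
      DD v (fun w => Ψ (s, w)) w = DD ((0 : ℝ), v) Ψ (s, w) := by
    intro Ψ hΨ s w
    exact fd_slot hΨ (p := fun w => (s, w)) (ContinuousLinearMap.inr ℝ ℝ X) (by intro z; simp) w v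
  have h2 : (fun w => deriv (fun s => Φ (s, w)) s) = fun w => DD ((1 : ℝ), (0 : X)) Φ (s, w) := by
    funext w; exact (h0 hΦ s w).deriv
  rw [h2, h1 (hΦ.DD _)]
  simp only [h1 hΦ]
  rw [DD_comm hΦ]
  exact h0 (hΦ.DD _) s w

lemma norm_iter_DD {f : X → F} (hf : Sm f) (v : X) (m : ℕ) (q : X) :
    ‖iteratedFDeriv ℝ m (DD v f) q‖ ≤ ‖v‖ * ‖iteratedFDeriv ℝ (m + 1) f q‖ := by
  rw [← norm_iteratedFDeriv_fderiv]
  exact norm_iteratedFDeriv_clm_apply_const (N := (⊤ : ℕ∞)) hf.fderiv'.contDiffAt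
    (by exact_mod_cast le_top)

/-- Polynomial growth with all derivatives. -/
structure PG (b : X → ℝ) : Prop where
  sm : Sm b
  gr : ∀ k : ℕ, ∃ C : ℝ, ∃ m : ℕ, ∀ q, ‖iteratedFDeriv ℝ k b q‖ ≤ C * (1 + ‖q‖) ^ m

lemma PG.DD {b : X → ℝ} (hb : PG b) (v : X) : PG (DD v b) := by
  refine ⟨hb.sm.DD v, fun k => ?_⟩
  obtain ⟨C, m, h⟩ := hb.gr (k + 1)
  refine ⟨‖v‖ * C, m, fun q => (norm_iter_DD hb.sm v k q).trans ?_⟩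
  rw [mul_assoc]
  exact mul_le_mul_of_nonneg_left (h q) (norm_nonneg _)

/-- Families of Schwartz functions, locally uniformly in the parameter. -/
structure US (f : ℝ → X → ℂ) : Prop where
  sm : ∀ s, Sm (f s)
  dec : ∀ (m N : ℕ) (T : ℝ), ∃ C : ℝ, ∀ s : ℝ, |s| ≤ T → ∀ q,
    (1 + ‖q‖) ^ N * ‖iteratedFDeriv ℝ m (f s) q‖ ≤ C

lemma US.DD {f : ℝ → X → ℂ} (hf : US f) (v : X) : US (fun s => DD v (f s)) := by
  refine ⟨fun s => (hf.sm s).DD v, fun m N T => ?_⟩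
  obtain ⟨C, h⟩ := hf.dec (m + 1) N T
  refine ⟨‖v‖ * C, fun s hs q => ?_⟩
  calc (1 + ‖q‖) ^ N * ‖iteratedFDeriv ℝ m (_root_.DD v (f s)) q‖
      ≤ (1 + ‖q‖) ^ N * (‖v‖ * ‖iteratedFDeriv ℝ (m + 1) (f s) q‖) := by
        gcongr; exact norm_iter_DD (hf.sm s) v m q
    _ = ‖v‖ * ((1 + ‖q‖) ^ N * ‖iteratedFDeriv ℝ (m + 1) (f s) q‖) := by ring
    _ ≤ _ := by gcongr; exact h s hs q

lemma US.comp {f : ℝ → Y → ℂ} (hf : US f) (L : X →L[ℝ] Y) (hL : ∀ q, ‖q‖ ≤ ‖L q‖) :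
    US (fun s q => f s (L q)) := by
  refine ⟨fun s => ContDiff.comp (hf.sm s) L.contDiff, fun m N T => ?_⟩
  obtain ⟨C, h⟩ := hf.dec m N T
  refine ⟨C * ‖L‖ ^ m, fun s hs q => ?_⟩
  have h1 := L.iteratedFDeriv_comp_right (hf.sm s) q (i := m) (by exact_mod_cast le_top)
  have h2 : ‖iteratedFDeriv ℝ m (fun q => f s (L q)) q‖
      ≤ ‖iteratedFDeriv ℝ m (f s) (L q)‖ * ‖L‖ ^ m := by
    have := ContinuousMultilinearMap.norm_compContinuousLinearMap_le
      (iteratedFDeriv ℝ m (f s) (L q)) (fun _ => L)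
    rw [← h1] at this
    simpa [Function.comp_def] using this
  calc (1 + ‖q‖) ^ N * ‖iteratedFDeriv ℝ m (fun q => f s (L q)) q‖
      ≤ (1 + ‖L q‖) ^ N * (‖iteratedFDeriv ℝ m (f s) (L q)‖ * ‖L‖ ^ m) := by
        gcongr; exact hL q
    _ = (1 + ‖L q‖) ^ N * ‖iteratedFDeriv ℝ m (f s) (L q)‖ * ‖L‖ ^ m := by ring
    _ ≤ _ := by gcongr; exact h s hs _

/-- uniform rapid decay of a family (no derivatives), with continuity. -/
structure UD (f : ℝ → X → ℂ) : Prop where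
  ct : ∀ s, Continuous (f s)
  dec : ∀ (N : ℕ) (T : ℝ), ∃ C : ℝ, ∀ s : ℝ, |s| ≤ T → ∀ q, (1 + ‖q‖) ^ N * ‖f s q‖ ≤ C

lemma US.ud {f : ℝ → X → ℂ} (hf : US f) : UD f :=
  ⟨fun s => (hf.sm s).continuous, fun N T => by simpa using hf.dec 0 N T⟩

lemma UD.add {f g : ℝ → X → ℂ} (hf : UD f) (hg : UD g) : UD (fun s q => f s q + g s q) := by
  refine ⟨fun s => (hf.ct s).add (hg.ct s), fun N T => ?_⟩
  obtain ⟨C, h⟩ := hf.dec N T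
  obtain ⟨C', h'⟩ := hg.dec N T
  refine ⟨C + C', fun s hs q => ?_⟩
  calc _ ≤ (1 + ‖q‖) ^ N * (‖f s q‖ + ‖g s q‖) := by gcongr; exact norm_add_le _ _
    _ ≤ _ := by rw [mul_add]; exact add_le_add (h s hs q) (h' s hs q)

lemma UD.cmul {f : ℝ → X → ℂ} (hf : UD f) (c : ℂ) : UD (fun s q => c * f s q) := by
  refine ⟨fun s => continuous_const.mul (hf.ct s), fun N T => ?_⟩
  obtain ⟨C, h⟩ := hf.dec N T
  refine ⟨‖c‖ * C, fun s hs q => ?_⟩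
  rw [norm_mul]
  calc _ = ‖c‖ * ((1 + ‖q‖) ^ N * ‖f s q‖) := by ring
    _ ≤ _ := by gcongr; exact h s hs q

lemma UD.zero : UD (fun (_ : ℝ) (_ : X) => (0 : ℂ)) :=
  ⟨fun _ => continuous_const, fun _ _ => ⟨0, fun _ _ _ => by simp⟩⟩

lemma UD.sum {ι : Type*} (S : Finset ι) {f : ι → ℝ → X → ℂ} (hf : ∀ i, UD (f i)) :
    UD (fun s q => ∑ i ∈ S, f i s q) := by
  classical
  induction S using Finset.induction_on with
  | empty => simpa using UD.zero
  | insert i S hi ih => simp only [Finset.sum_insert hi]; exact (hf i).add ih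

lemma UD.smul {f : ℝ → X → ℂ} (hf : UD f) {b : X → ℝ} (hb : PG b) :
    UD (fun s q => b q • f s q) := by
  refine ⟨fun s => hb.sm.continuous.smul (hf.ct s), fun N T => ?_⟩
  obtain ⟨C, m, h⟩ := hb.gr 0
  obtain ⟨C', h'⟩ := hf.dec (N + m) T
  have hC : 0 ≤ C := by
    have := (norm_nonneg _).trans (h 0); simpa using this
  refine ⟨C * C', fun s hs q => ?_⟩
  have hq := h q
  rw [norm_iteratedFDeriv_zero] at hq
  rw [norm_smul]
  calc _ ≤ (1 + ‖q‖) ^ N * ((C * (1 + ‖q‖) ^ m) * ‖f s q‖) := by gcongr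
    _ = C * ((1 + ‖q‖) ^ (N + m) * ‖f s q‖) := by ring
    _ ≤ _ := by gcongr; exact h' s hs q

variable [FiniteDimensional ℝ X] [MeasurableSpace X] [BorelSpace X]
  (μ : Measure X) [μ.IsAddHaarMeasure]

lemma UD.bound {f : ℝ → X → ℂ} (hf : UD f) (T : ℝ) : ∃ B : X → ℝ, Integrable B μ ∧
    ∀ s, |s| ≤ T → ∀ q, ‖f s q‖ ≤ B q := by
  obtain ⟨C, h⟩ := hf.dec (Module.finrank ℝ X + 1) T
  refine ⟨fun q => C * (1 + ‖q‖) ^ (-((Module.finrank ℝ X + 1 : ℕ) : ℝ)), ?_, fun s hs q => ?_⟩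
  · exact (integrable_one_add_norm (by push_cast; linarith)).const_mul C
  · have hp : 0 < 1 + ‖q‖ := by positivity
    beta_reduce
    rw [Real.rpow_neg hp.le, Real.rpow_natCast, ← div_eq_mul_inv, le_div_iff₀ (by positivity),
      mul_comm]
    exact h s hs q

lemma UD.int {f : ℝ → X → ℂ} (hf : UD f) (t : ℝ) : Integrable (f t) μ := by
  obtain ⟨B, hB, h⟩ := hf.bound μ |t|
  exact hB.mono' (hf.ct t).aestronglyMeasurable (Filter.Eventually.of_forall (h t le_rfl))

lemma UD.deriv_int {f f' : ℝ → X → ℂ} (hf : UD f) (hf' : UD f')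
    (hd : ∀ s q, HasDerivAt (fun s => f s q) (f' s q) s) (t : ℝ) :
    HasDerivAt (fun s => ∫ q, f s q ∂μ) (∫ q, f' t q ∂μ) t := by
  obtain ⟨B, hB, h⟩ := hf'.bound μ (|t| + 1)
  refine (hasDerivAt_integral_of_dominated_loc_of_deriv_le (bound := B) (Metric.ball_mem_nhds t one_pos)
    (Filter.Eventually.of_forall fun s => (hf.ct s).aestronglyMeasurable) (hf.int μ t)
    (hf'.ct t).aestronglyMeasurable (Filter.Eventually.of_forall fun q s hs => h s ?_ q) hB
    (Filter.Eventually.of_forall fun q s _ => hd s q)).2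
  rw [Metric.mem_ball, Real.dist_eq] at hs
  have := abs_add_le (s - t) t
  rw [sub_add_cancel] at this
  linarith

lemma ibp {f : ℝ → X → ℂ} (hf : US f) {b : X → ℝ} (hb : PG b) (v : X) (t : ℝ) :
    ∫ q, b q • DD v (f t) q ∂μ = - ∫ q, DD v b q • f t q ∂μ :=
  integral_smul_fderiv_eq_neg_fderiv_smul_of_integrable
    ((hf.ud.smul (hb.DD v)).int μ t) (((hf.DD v).ud.smul hb).int μ t)
    ((hf.ud.smul hb).int μ t) (fun _ _ => hb.sm.diff _) (fun _ _ => (hf.sm t).diff _)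

end Gen

section Spec

variable {d : ℕ}

abbrev Wk (k d : ℕ) := (Fin k → Ed d) × (Fin k → Ed d)

abbrev ee (m : Fin d) : Ed d := EuclideanSpace.single m 1

def iA (k : ℕ) (j : Fin k) : Ed d →L[ℝ] Wk k d :=
  (ContinuousLinearMap.inl ℝ _ _).comp (ContinuousLinearMap.single ℝ (fun _ => Ed d) j)
def iB (k : ℕ) (j : Fin k) : Ed d →L[ℝ] Wk k d :=
  (ContinuousLinearMap.inr ℝ _ _).comp (ContinuousLinearMap.single ℝ (fun _ => Ed d) j)

@[simp] lemma iA_apply (k : ℕ) (j : Fin k) (z : Ed d) : iA k j z = (Pi.single j z, 0) := rfl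
@[simp] lemma iB_apply (k : ℕ) (j : Fin k) (z : Ed d) : iB k j z = (0, Pi.single j z) := rfl

/-- diagonal embedding -/
def del : Ed d × Ed d →L[ℝ] Wk 2 d :=
  LinearMap.toContinuousLinearMap
  { toFun := fun q => (![q.1, q.2], ![q.1, q.2])
    map_add' := by intro p q; ext i <;> fin_cases i <;> simp
    map_smul' := by intro c q; ext i <;> fin_cases i <;> simp }

@[simp] lemma del_apply (q : Ed d × Ed d) : del q = (![q.1, q.2], ![q.1, q.2]) := rfl

def del3 : Ed d × Ed d →L[ℝ] Wk 3 d :=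
  LinearMap.toContinuousLinearMap
  { toFun := fun q => (![q.1, q.2, q.1], ![q.1, q.2, q.1])
    map_add' := by intro p q; ext i <;> fin_cases i <;> simp
    map_smul' := by intro c q; ext i <;> fin_cases i <;> simp }

@[simp] lemma del3_apply (q : Ed d × Ed d) :
    del3 q = (![q.1, q.2, q.1], ![q.1, q.2, q.1]) := rfl

def LA (j : Fin 2) : Wk 2 d →L[ℝ] Wk 3 d :=
  LinearMap.toContinuousLinearMap
  { toFun := fun w => (![w.1 0, w.1 1, w.1 j], ![w.2 0, w.2 1, w.1 j])
    map_add' := by intro p q; ext i <;> fin_cases i <;> simp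
    map_smul' := by intro c q; ext i <;> fin_cases i <;> simp }

@[simp] lemma LA_apply (j : Fin 2) (w : Wk 2 d) :
    LA j w = (![w.1 0, w.1 1, w.1 j], ![w.2 0, w.2 1, w.1 j]) := rfl

def LB (j : Fin 2) : Wk 2 d →L[ℝ] Wk 3 d :=
  LinearMap.toContinuousLinearMap
  { toFun := fun w => (![w.1 0, w.1 1, w.2 j], ![w.2 0, w.2 1, w.2 j])
    map_add' := by intro p q; ext i <;> fin_cases i <;> simp
    map_smul' := by intro c q; ext i <;> fin_cases i <;> simp }

@[simp] lemma LB_apply (j : Fin 2) (w : Wk 2 d) :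
    LB j w = (![w.1 0, w.1 1, w.2 j], ![w.2 0, w.2 1, w.2 j]) := rfl

/-- exchange of particles one and three -/
def sw : Wk 3 d →L[ℝ] Wk 3 d :=
  LinearMap.toContinuousLinearMap
  { toFun := fun w => (w.1 ∘ Equiv.swap 0 2, w.2 ∘ Equiv.swap 0 2)
    map_add' := by intro p q; ext i <;> simp
    map_smul' := by intro c q; ext i <;> simp }

@[simp] lemma sw_apply (w : Wk 3 d) :
    sw w = (w.1 ∘ Equiv.swap 0 2, w.2 ∘ Equiv.swap 0 2) := rfl

lemma norm_del (q : Ed d × Ed d) : ‖q‖ ≤ ‖del q‖ := by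
  rw [Prod.norm_def q]
  refine max_le ?_ ?_
  · exact (norm_le_pi_norm (del q).1 0).trans (norm_fst_le _)
  · exact (norm_le_pi_norm (del q).1 1).trans (norm_fst_le _)

lemma norm_del3 (q : Ed d × Ed d) : ‖q‖ ≤ ‖del3 q‖ := by
  rw [Prod.norm_def q]
  refine max_le ?_ ?_
  · exact (norm_le_pi_norm (del3 q).1 0).trans (norm_fst_le _)
  · exact (norm_le_pi_norm (del3 q).1 1).trans (norm_fst_le _)

def e1 (m : Fin d) : Ed d × Ed d := (ee m, 0)
def e2 (m : Fin d) : Ed d × Ed d := (0, ee m)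

def Sv (j : Fin 2) (m : Fin d) : Wk 2 d := iA 2 j (ee m) + iB 2 j (ee m)
def Nv (j : Fin 2) (m : Fin d) : Wk 2 d := iA 2 j (ee m) - iB 2 j (ee m)

lemma del_e1 (m : Fin d) : del (e1 m) = Sv 0 m := by
  apply Prod.ext <;> funext i <;> fin_cases i <;> simp [e1, Sv]
lemma del_e2 (m : Fin d) : del (e2 m) = Sv 1 m := by
  apply Prod.ext <;> funext i <;> fin_cases i <;> simp [e2, Sv]

/-- the kernel as a function on phase space -/
def GG (γ : (k : ℕ) → ℝ → (Fin k → Ed d) → (Fin k → Ed d) → ℂ) (k : ℕ) (s : ℝ) : Wk k d → ℂ :=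
  fun w => γ k s w.1 w.2

variable {lam : ℝ} {γ : (k : ℕ) → ℝ → (Fin k → Ed d) → (Fin k → Ed d) → ℂ}

lemma GG_us (hγ : GPSolution d lam γ) (k : ℕ) : US (GG γ k) := by
  refine ⟨fun s => ?_, fun m N T => hγ.decay k m N T⟩
  exact (hγ.smooth k).comp (contDiff_const.prodMk contDiff_id)

lemma lap1 (hγ : GPSolution d lam γ) (t : ℝ) (j : Fin 2) (w : Wk 2 d) :
    lapAt j (fun z => γ 2 t z w.2) w.1
      = ∑ m, DD (iA 2 j (ee m)) (DD (iA 2 j (ee m)) (GG γ 2 t)) w := by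
  have hs := (GG_us hγ 2).sm t
  have hp : ∀ z : Fin 2 → Ed d, (z, w.2) = ((0 : Fin 2 → Ed d), w.2)
      + ContinuousLinearMap.inl ℝ _ _ z := by intro z; simp
  simp only [lapAt]
  refine Finset.sum_congr rfl fun m _ => ?_
  have h1 : ∀ z, fderiv ℝ (fun z => γ 2 t z w.2) z (Pi.single j (ee m))
      = DD (iA 2 j (ee m)) (GG γ 2 t) (z, w.2) := fun z =>
    fd_slot hs (p := fun z => (z, w.2)) _ hp z _
  simp only [h1]
  exact fd_slot (hs.DD _) (p := fun z => (z, w.2)) _ hp w.1 _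

lemma lap2 (hγ : GPSolution d lam γ) (t : ℝ) (j : Fin 2) (w : Wk 2 d) :
    lapAt j (γ 2 t w.1) w.2
      = ∑ m, DD (iB 2 j (ee m)) (DD (iB 2 j (ee m)) (GG γ 2 t)) w := by
  have hs := (GG_us hγ 2).sm t
  have hp : ∀ z : Fin 2 → Ed d, (w.1, z) = (w.1, (0 : Fin 2 → Ed d))
      + ContinuousLinearMap.inr ℝ _ _ z := by intro z; simp
  simp only [lapAt]
  refine Finset.sum_congr rfl fun m _ => ?_
  have h1 : ∀ z, fderiv ℝ (γ 2 t w.1) z (Pi.single j (ee m))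
      = DD (iB 2 j (ee m)) (GG γ 2 t) (w.1, z) := fun z =>
    fd_slot hs (p := fun z => (w.1, z)) _ hp z _
  simp only [h1]
  exact fd_slot (hs.DD _) (p := fun z => (w.1, z)) _ hp w.2 _

lemma snoc3 (x : Fin 2 → Ed d) (z : Ed d) :
    (Fin.snoc x z : Fin 3 → Ed d) = ![x 0, x 1, z] := by
  funext i
  fin_cases i <;> rfl

lemma tau_eq (hγ : GPSolution d lam γ) (t : ℝ) :
    (fun w : Wk 2 d => deriv (fun s => γ 2 s w.1 w.2) t)
      = fun w => ∑ j : Fin 2, (I * (∑ m, DD (Sv j m) (DD (Nv j m) (GG γ 2 t)) w)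
          + (-I * lam) * (GG γ 3 t (LA j w) - GG γ 3 t (LB j w))) := by
  funext w
  have h := hγ.eq 2 t w.1 w.2
  have hs := (GG_us hγ 2).sm t
  have h2 : deriv (fun s => γ 2 s w.1 w.2) t
      = -I * (I * deriv (fun s => γ 2 s w.1 w.2) t) := by
    rw [← mul_assoc]; simp
  rw [h2, h]
  simp only [lap1 hγ, lap2 hγ, ← Finset.sum_sub_distrib, Bcoll, snoc3]
  have h3 : ∀ (j : Fin 2) (m : Fin d), DD (Sv j m) (DD (Nv j m) (GG γ 2 t)) w
     = DD (iA 2 j (ee m)) (DD (iA 2 j (ee m)) (GG γ 2 t)) w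
      - DD (iB 2 j (ee m)) (DD (iB 2 j (ee m)) (GG γ 2 t)) w := fun j m =>
    (congrFun (DD_sq_sub hs (iA 2 j (ee m)) (iB 2 j (ee m))) w).symm
  simp only [h3, GG, LA_apply, LB_apply, Fin.sum_univ_two]
  ring

lemma coll (hγ : GPSolution d lam γ) (t : ℝ) (ℓ : Fin d) (q : Ed d × Ed d) :
    ∑ j : Fin 2, (DD (Nv 0 ℓ) (fun w => GG γ 3 t (LA j w)) (del q)
      - DD (Nv 0 ℓ) (fun w => GG γ 3 t (LB j w)) (del q))
    = DD (e1 ℓ) (fun q => GG γ 3 t (del3 q)) q := by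
  have hs := ((GG_us hγ 3).sm t)
  have hd := hs.diff
  simp only [DD_comp0 hd, Fin.sum_univ_two]
  have a1 : LA 1 (Nv 0 ℓ) = LB 1 (Nv 0 ℓ) := by
    apply Prod.ext <;> funext i <;> fin_cases i <;> simp [Nv]
  have a2 : LA 1 (del q) = LB 1 (del q) := by
    apply Prod.ext <;> funext i <;> fin_cases i <;> simp
  have a3 : LA 0 (del q) = del3 q := by
    apply Prod.ext <;> funext i <;> fin_cases i <;> simp
  have a4 : LB 0 (del q) = del3 q := by
    apply Prod.ext <;> funext i <;> fin_cases i <;> simp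
  rw [a1, a2, a3, a4, sub_self, add_zero]
  set c0 : Wk 3 d := iA 3 0 (ee ℓ) + iB 3 0 (ee ℓ) with hc0
  set c2 : Wk 3 d := iA 3 2 (ee ℓ) + iB 3 2 (ee ℓ) with hc2
  have b1 : LA 0 (Nv 0 ℓ) = (LB 0 (Nv 0 ℓ) : Wk 3 d) + (c2 + c2) := by
    apply Prod.ext <;> funext i <;> fin_cases i <;>
      simp [Nv, hc2, Matrix.vecHead, Matrix.vecTail]
  have b2 : del3 (e1 ℓ) = c0 + c2 := by
    apply Prod.ext <;> funext i <;> fin_cases i <;> simp [e1, hc0, hc2]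
  have b3 : (fun w => GG γ 3 t (sw w)) = GG γ 3 t := by
    funext w
    exact hγ.symm 3 t _ w.1 w.2
  have b4 : sw c2 = c0 := by
    apply Prod.ext <;> funext i <;> fin_cases i <;>
      simp [hc0, hc2, Equiv.swap_apply_def]
  have b5 : sw (del3 q) = del3 q := by
    apply Prod.ext <;> funext i <;> fin_cases i <;>
      simp [Equiv.swap_apply_def]
  have b6 : DD c2 (GG γ 3 t) (del3 q) = DD c0 (GG γ 3 t) (del3 q) := by
    have := congrFun (DD_comp0 hd sw c2) (del3 q)
    rw [b3, b4, b5] at this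
    exact this
  rw [b1, b2]
  simp only [DD_add_dir, Pi.add_apply]
  rw [b6]; ring

/-- The momentum density along the diagonal. -/
def PP (γ : (k : ℕ) → ℝ → (Fin k → Ed d) → (Fin k → Ed d) → ℂ) (ℓ : Fin d) (s : ℝ)
    (q : Ed d × Ed d) : ℂ := (1 / (2 * I)) * DD (Nv 0 ℓ) (GG γ 2 s) (del q)

/-- second-derivative densities -/
def TT (γ : (k : ℕ) → ℝ → (Fin k → Ed d) → (Fin k → Ed d) → ℂ) (j : Fin 2) (ℓ m : Fin d) (s : ℝ)
    (q : Ed d × Ed d) : ℂ := DD (Nv 0 ℓ) (DD (Nv j m) (GG γ 2 s)) (del q)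

def RR (γ : (k : ℕ) → ℝ → (Fin k → Ed d) → (Fin k → Ed d) → ℂ) (s : ℝ)
    (q : Ed d × Ed d) : ℂ := GG γ 2 s (del q)

def HH (γ : (k : ℕ) → ℝ → (Fin k → Ed d) → (Fin k → Ed d) → ℂ) (s : ℝ)
    (q : Ed d × Ed d) : ℂ := GG γ 3 s (del3 q)

lemma TT_us (hγ : GPSolution d lam γ) (j : Fin 2) (ℓ m : Fin d) : US (TT γ j ℓ m) :=
  (((GG_us hγ 2).DD (Nv j m)).DD (Nv 0 ℓ)).comp del norm_del
lemma RR_us (hγ : GPSolution d lam γ) : US (RR γ) := (GG_us hγ 2).comp del norm_del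
lemma HH_us (hγ : GPSolution d lam γ) : US (HH γ) := (GG_us hγ 3).comp del3 norm_del3
lemma PP_ud (hγ : GPSolution d lam γ) (ℓ : Fin d) : UD (PP γ ℓ) :=
  (((GG_us hγ 2).DD (Nv 0 ℓ)).comp del norm_del).ud.cmul _

/-- time derivative of the momentum density -/
def dP (lam : ℝ) (γ : (k : ℕ) → ℝ → (Fin k → Ed d) → (Fin k → Ed d) → ℂ) (ℓ : Fin d) (s : ℝ)
    (q : Ed d × Ed d) : ℂ :=
  (1 / 2 : ℂ) * ((∑ m, DD (e1 m) (TT γ 0 ℓ m s) q) + ∑ m, DD (e2 m) (TT γ 1 ℓ m s) q)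
    + (-(lam / 2) : ℂ) * DD (e1 ℓ) (HH γ s) q

lemma dP_ud (hγ : GPSolution d lam γ) (ℓ : Fin d) : UD (dP lam γ ℓ) :=
  (((UD.sum _ fun m => ((TT_us hγ 0 ℓ m).DD (e1 m)).ud).add
    (UD.sum _ fun m => ((TT_us hγ 1 ℓ m).DD (e2 m)).ud)).cmul _).add
    (((HH_us hγ).DD (e1 ℓ)).ud.cmul _)

lemma dP_deriv (hγ : GPSolution d lam γ) (ℓ : Fin d) (t : ℝ) (q : Ed d × Ed d) :
    HasDerivAt (fun s => PP γ ℓ s q) (dP lam γ ℓ t q) t := by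
  have h := (param_deriv (hγ.smooth 2) (Nv 0 ℓ) t (del q)).const_mul (1 / (2 * I))
  suffices hh : dP lam γ ℓ t q = (1 / (2 * I)) *
      DD (Nv 0 ℓ) (fun w : Wk 2 d => deriv (fun s => γ 2 s w.1 w.2) t) (del q) by
    rw [hh]; exact h
  have hs := (GG_us hγ 2).sm t
  have hs3 := (GG_us hγ 3).sm t
  have hA : ∀ j, Sm (fun w => GG γ 3 t (LA j w)) := fun j => ContDiff.comp hs3 (LA j).contDiff
  have hB : ∀ j, Sm (fun w => GG γ 3 t (LB j w)) := fun j => ContDiff.comp hs3 (LB j).contDiff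
  have hK : ∀ j : Fin 2, Sm (fun w => ∑ m, DD (Sv j m) (DD (Nv j m) (GG γ 2 t)) w) := fun j =>
    ContDiff.sum fun m _ => (hs.DD _).DD _
  have hK' : ∀ j : Fin 2, Sm (fun w => I * ∑ m, DD (Sv j m) (DD (Nv j m) (GG γ 2 t)) w) :=
    fun j => contDiff_const.mul (hK j)
  have hC : ∀ j : Fin 2, Sm (fun w => GG γ 3 t (LA j w) - GG γ 3 t (LB j w)) := fun j =>
    (hA j).sub (hB j)
  have hC' : ∀ j : Fin 2, Sm (fun w => (-I * lam) * (GG γ 3 t (LA j w) - GG γ 3 t (LB j w))) :=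
    fun j => contDiff_const.mul (hC j)
  have e : DD (Nv 0 ℓ) (fun w : Wk 2 d => deriv (fun s => γ 2 s w.1 w.2) t) (del q)
      = ∑ j : Fin 2, (I * (∑ m, DD (Nv 0 ℓ) (DD (Sv j m) (DD (Nv j m) (GG γ 2 t))) (del q))
          + (-I * lam) * (DD (Nv 0 ℓ) (fun w => GG γ 3 t (LA j w)) (del q)
            - DD (Nv 0 ℓ) (fun w => GG γ 3 t (LB j w)) (del q))) := by
    rw [tau_eq hγ, DD_sum _ (fun j => (hK' j).add (hC' j))]
    refine Finset.sum_congr rfl fun j _ => ?_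
    have z1 := congrFun (DD_add (hK' j) (hC' j) (Nv 0 ℓ)) (del q)
    have z2 := congrFun (DD_cmul (hK j) I (Nv 0 ℓ)) (del q)
    have z3 := congrFun (DD_cmul (hC j) (-I * lam) (Nv 0 ℓ)) (del q)
    have z4 := congrFun (DD_sub (hA j) (hB j) (Nv 0 ℓ)) (del q)
    have z5 := congrFun (DD_sum Finset.univ
      (fun m => (hs.DD (Nv j m)).DD (Sv j m)) (Nv 0 ℓ)) (del q)
    refine z1.trans ?_
    rw [Pi.add_apply, z2, z3, z5]
    congr 2
  rw [e, Finset.sum_add_distrib, ← Finset.mul_sum, ← Finset.mul_sum, coll hγ, Fin.sum_univ_two]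
  have hc : ∀ (j : Fin 2) (m : Fin d),
      DD (Nv 0 ℓ) (DD (Sv j m) (DD (Nv j m) (GG γ 2 t))) (del q)
      = DD (Sv j m) (DD (Nv 0 ℓ) (DD (Nv j m) (GG γ 2 t))) (del q) := fun j m =>
    congrFun (DD_comm (hs.DD _) _ _) _
  have h0 : ∀ m, DD (e1 m) (TT γ 0 ℓ m t) q
      = DD (Nv 0 ℓ) (DD (Sv 0 m) (DD (Nv 0 m) (GG γ 2 t))) (del q) := by
    intro m
    rw [hc, ← del_e1]
    exact congrFun (DD_comp0 ((hs.DD _).DD _).diff del (e1 m)) q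
  have h1 : ∀ m, DD (e2 m) (TT γ 1 ℓ m t) q
      = DD (Nv 0 ℓ) (DD (Sv 1 m) (DD (Nv 1 m) (GG γ 2 t))) (del q) := by
    intro m
    rw [hc, ← del_e2]
    exact congrFun (DD_comp0 ((hs.DD _).DD _).diff del (e2 m)) q
  simp only [dP, h0, h1]
  have hH : (fun q => GG γ 3 t (del3 q)) = HH γ t := rfl
  rw [hH]
  field_simp

def UU (γ : (k : ℕ) → ℝ → (Fin k → Ed d) → (Fin k → Ed d) → ℂ) (j ℓ : Fin d) (s : ℝ)
    (q : Ed d × Ed d) : ℂ := DD (iB 2 0 (ee j)) (DD (iA 2 0 (ee ℓ)) (GG γ 2 s)) (del q)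

lemma UU_us (hγ : GPSolution d lam γ) (j ℓ : Fin d) : US (UU γ j ℓ) :=
  (((GG_us hγ 2).DD _).DD _).comp del norm_del

lemma TT_eq (hγ : GPSolution d lam γ) (ℓ m : Fin d) (t : ℝ) (q : Ed d × Ed d) :
    TT γ 0 ℓ m t q = DD (e1 ℓ) (DD (e1 m) (RR γ t)) q
      - 2 * UU γ m ℓ t q - 2 * UU γ ℓ m t q := by
  have hs := (GG_us hγ 2).sm t
  have h1 : DD (e1 m) (RR γ t) = fun q => DD (Sv 0 m) (GG γ 2 t) (del q) := by
    rw [← del_e1]; exact DD_comp0 hs.diff del (e1 m)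
  have h2 : DD (e1 ℓ) (DD (e1 m) (RR γ t)) = fun q => DD (Sv 0 ℓ) (DD (Sv 0 m) (GG γ 2 t)) (del q) := by
    rw [h1, ← del_e1 ℓ]; exact DD_comp0 (hs.DD _).diff del (e1 ℓ)
  rw [h2]
  simp only [TT, UU]
  have hA := hs.DD (iA 2 0 (ee m))
  have hB := hs.DD (iB 2 0 (ee m))
  rw [Sv, Sv, Nv, Nv, DD_add_dir, DD_sub_dir, DD_add_dir, DD_sub_dir (iA 2 0 (ee m)),
    DD_add hA hB, DD_add hA hB, DD_sub hA hB, DD_sub hA hB,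
    DD_comm hs (iA 2 0 (ee ℓ)) (iB 2 0 (ee m))]
  simp only [Pi.add_apply, Pi.sub_apply]
  ring

lemma T1 (hγ : GPSolution d lam γ) (ℓ : Fin d) (s : ℝ) (x y : Ed d) :
    Pmom2 (γ 2 s) ℓ x y = PP γ ℓ s (x, y) := by
  have hs := (GG_us hγ 2).sm s
  have h1 : fderiv ℝ (fun z => γ 2 s ![z, y] ![x, y]) x (ee ℓ)
      = DD (iA 2 0 (ee ℓ)) (GG γ 2 s) (![x, y], ![x, y]) :=
    fd_slot hs (p := fun z => (![z, y], ![x, y])) (iA 2 0) (by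
      intro z; apply Prod.ext <;> funext i <;> fin_cases i <;> simp [Matrix.vecHead, Matrix.vecTail]) x _
  have h2 : fderiv ℝ (fun z => γ 2 s ![x, y] ![z, y]) x (ee ℓ)
      = DD (iB 2 0 (ee ℓ)) (GG γ 2 s) (![x, y], ![x, y]) :=
    fd_slot hs (p := fun z => (![x, y], ![z, y])) (iB 2 0) (by
      intro z; apply Prod.ext <;> funext i <;> fin_cases i <;> simp [Matrix.vecHead, Matrix.vecTail]) x _
  simp only [Pmom2, PP, Nv, DD_sub_dir]
  rw [h1, h2]
  simp

lemma slot2 {f : Wk 2 d → ℂ} (hf : Sm f) {p : Ed d → Ed d → Wk 2 d} (L K : Ed d →L[ℝ] Wk 2 d)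
    (hp : ∀ w z, p w z = p 0 0 + L z + K w) (x y e e' : Ed d) :
    fderiv ℝ (fun w => fderiv ℝ (fun z => f (p w z)) x e) y e'
      = DD (K e') (DD (L e) f) (p y x) := by
  have h1 : ∀ w, fderiv ℝ (fun z => f (p w z)) x e = DD (L e) f (p w x) := fun w =>
    fd_slot hf (p := p w) L (by intro z; rw [hp w z, hp w 0]; simp; abel) x e
  simp only [h1]
  exact fd_slot (hf.DD _) (p := fun w => p w x) K
    (by intro w; beta_reduce; rw [hp w x, hp 0 x]; simp) y e'

lemma T2 (hγ : GPSolution d lam γ) (j ℓ : Fin d) (t : ℝ) (x y : Ed d) :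
    Qcorr (γ 2 t) j ℓ x y = (-(1 / 4) : ℂ) * TT γ 1 j ℓ t (x, y) := by
  have hs := (GG_us hγ 2).sm t
  have h1 : fderiv ℝ (fun w => fderiv ℝ (fun z => γ 2 t ![z, w] ![x, y]) x (ee j)) y (ee ℓ)
      = DD (iA 2 1 (ee ℓ)) (DD (iA 2 0 (ee j)) (GG γ 2 t)) (![x, y], ![x, y]) :=
    slot2 hs (p := fun w z => (![z, w], ![x, y])) (iA 2 0) (iA 2 1) (by
      intro w z; apply Prod.ext <;> funext i <;> fin_cases i <;> simp [Matrix.vecHead, Matrix.vecTail]) x y _ _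
  have h2 : fderiv ℝ (fun w => fderiv ℝ (fun z => γ 2 t ![z, y] ![x, w]) x (ee j)) y (ee ℓ)
      = DD (iB 2 1 (ee ℓ)) (DD (iA 2 0 (ee j)) (GG γ 2 t)) (![x, y], ![x, y]) :=
    slot2 hs (p := fun w z => (![z, y], ![x, w])) (iA 2 0) (iB 2 1) (by
      intro w z; apply Prod.ext <;> funext i <;> fin_cases i <;> simp [Matrix.vecHead, Matrix.vecTail]) x y _ _
  have h3 : fderiv ℝ (fun w => fderiv ℝ (fun z => γ 2 t ![x, w] ![z, y]) x (ee j)) y (ee ℓ)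
      = DD (iA 2 1 (ee ℓ)) (DD (iB 2 0 (ee j)) (GG γ 2 t)) (![x, y], ![x, y]) :=
    slot2 hs (p := fun w z => (![x, w], ![z, y])) (iB 2 0) (iA 2 1) (by
      intro w z; apply Prod.ext <;> funext i <;> fin_cases i <;> simp [Matrix.vecHead, Matrix.vecTail]) x y _ _
  have h4 : fderiv ℝ (fun w => fderiv ℝ (fun z => γ 2 t ![x, y] ![z, w]) x (ee j)) y (ee ℓ)
      = DD (iB 2 1 (ee ℓ)) (DD (iB 2 0 (ee j)) (GG γ 2 t)) (![x, y], ![x, y]) :=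
    slot2 hs (p := fun w z => (![x, y], ![z, w])) (iB 2 0) (iB 2 1) (by
      intro w z; apply Prod.ext <;> funext i <;> fin_cases i <;> simp [Matrix.vecHead, Matrix.vecTail]) x y _ _
  simp only [Qcorr]
  rw [h1, h2, h3, h4]
  simp only [TT]
  rw [DD_comm hs (iA 2 1 (ee ℓ)) (iA 2 0 (ee j)), DD_comm hs (iB 2 1 (ee ℓ)) (iA 2 0 (ee j)),
    DD_comm hs (iA 2 1 (ee ℓ)) (iB 2 0 (ee j)), DD_comm hs (iB 2 1 (ee ℓ)) (iB 2 0 (ee j)),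
    Nv, Nv, DD_sub_dir (iA 2 0 (ee j)), DD_sub_dir (iA 2 1 (ee ℓ)),
    DD_sub (hs.DD _) (hs.DD _), DD_sub (hs.DD _) (hs.DD _)]
  simp only [Pi.sub_apply, del_apply]
  ring

lemma T3 (hγ : GPSolution d lam γ) (ℓ : Fin d) (t : ℝ) (x y : Ed d) :
    fderiv ℝ (fun z => fderiv ℝ (fun w => γ 2 t ![w, y] ![w, y]) z (ee ℓ)) x (ee ℓ)
      = DD (e1 ℓ) (DD (e1 ℓ) (RR γ t)) (x, y) := by
  have hs := (RR_us hγ).sm t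
  have hp : ∀ z : Ed d, (z, y) = ((0 : Ed d), y) + ContinuousLinearMap.inl ℝ _ _ z := by
    intro z; simp
  have h1 : ∀ z, fderiv ℝ (fun w => γ 2 t ![w, y] ![w, y]) z (ee ℓ)
      = DD (e1 ℓ) (RR γ t) (z, y) := fun z =>
    fd_slot hs (p := fun z => (z, y)) _ hp z _
  simp only [h1]
  exact fd_slot (hs.DD _) (p := fun z => (z, y)) _ hp x _

lemma T5 (hγ : GPSolution d lam γ) (j ℓ : Fin d) (t : ℝ) (x y : Ed d) :
    fderiv ℝ (fun z' => fderiv ℝ (fun z => γ 2 t ![z, y] ![z', y]) x (ee ℓ)) x (ee j)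
      = UU γ j ℓ t (x, y) :=
  slot2 ((GG_us hγ 2).sm t) (p := fun w z => (![z, y], ![w, y])) (iA 2 0) (iB 2 0) (by
      intro w z; apply Prod.ext <;> funext i <;> fin_cases i <;> simp [Matrix.vecHead, Matrix.vecTail]) x x _ _

instance haarProd : (volume : Measure (Ed d × Ed d)).IsAddHaarMeasure := by
  rw [Measure.volume_eq_prod]; infer_instance

lemma fub {G : Ed d × Ed d → ℂ} (hG : Integrable G) :
    ∫ x : Ed d, ∫ y : Ed d, G (x, y) = ∫ q, G q := by
  rw [Measure.volume_eq_prod] at hG ⊢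
  exact (integral_prod G hG).symm

lemma fubRe {G : Ed d × Ed d → ℂ} (hG : Integrable G) :
    ∫ x : Ed d, ∫ y : Ed d, (G (x, y)).re = (∫ q, G q).re := by
  have h1 : ∫ q, (G q).re = (∫ q, G q).re := reCLM.integral_comp_comm hG
  rw [← h1]
  have hG' : Integrable (fun q => (G q).re) := hG.re
  rw [Measure.volume_eq_prod] at hG' ⊢
  exact (integral_prod _ hG').symm

/-- pairing of a weight with a density -/
def JJ (b : Ed d × Ed d → ℝ) (f : Ed d × Ed d → ℂ) : ℂ := ∫ q, b q • f q

lemma JJ_ibp {f : ℝ → Ed d × Ed d → ℂ} (hf : US f) {b : Ed d × Ed d → ℝ} (hb : PG b)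
    (v : Ed d × Ed d) (t : ℝ) : JJ b (DD v (f t)) = - JJ (DD v b) (f t) :=
  ibp volume hf hb v t

lemma JJ_sum {ι : Type*} (S : Finset ι) {f : ι → ℝ → Ed d × Ed d → ℂ} (hf : ∀ i, UD (f i))
    {b : ι → Ed d × Ed d → ℝ} (hb : ∀ i, PG (b i)) (t : ℝ) :
    ∫ q, ∑ i ∈ S, b i q • f i t q = ∑ i ∈ S, JJ (b i) (f i t) :=
  integral_finsetSum _ fun i _ => ((hf i).smul (hb i)).int volume t

lemma JJ_dP (hγ : GPSolution d lam γ) {b : Ed d × Ed d → ℝ} (hb : PG b) (ℓ : Fin d) (t : ℝ) :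
    JJ b (dP lam γ ℓ t) =
      (1 / 2 : ℂ) * ((∑ m, JJ b (DD (e1 m) (TT γ 0 ℓ m t))) + ∑ m, JJ b (DD (e2 m) (TT γ 1 ℓ m t)))
    + (-(lam / 2) : ℂ) * JJ b (DD (e1 ℓ) (HH γ t)) := by
  have u0 := fun m => ((TT_us hγ 0 ℓ m).DD (e1 m)).ud
  have u1 := fun m => ((TT_us hγ 1 ℓ m).DD (e2 m)).ud
  have u2 := ((HH_us hγ).DD (e1 ℓ)).ud
  have i0 := (UD.sum Finset.univ fun m => (u0 m).smul hb)
  have i1 := (UD.sum Finset.univ fun m => (u1 m).smul hb)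
  rw [← JJ_sum _ u0 (fun _ => hb), ← JJ_sum _ u1 (fun _ => hb),
    ← integral_add (i0.int volume t) (i1.int volume t)]
  simp only [JJ]
  rw [← integral_const_mul, ← integral_const_mul,
    ← integral_add (((i0.add i1).cmul _).int volume t) (((u2.smul hb).cmul _).int volume t)]
  refine integral_congr_ae (Filter.Eventually.of_forall fun q => ?_)
  simp only [dP, real_smul, ← Finset.mul_sum]
  ring

lemma JJ_TT (hγ : GPSolution d lam γ) {b : Ed d × Ed d → ℝ} (hb : PG b) (ℓ m : Fin d) (t : ℝ) :
    JJ b (TT γ 0 ℓ m t) = JJ b (DD (e1 ℓ) (DD (e1 m) (RR γ t)))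
      - 2 * JJ b (UU γ m ℓ t) - 2 * JJ b (UU γ ℓ m t) := by
  have i0 := ((((RR_us hγ).DD (e1 m)).DD (e1 ℓ)).ud.smul hb).int volume t
  have i1 := (((UU_us hγ m ℓ).ud.smul hb).int volume t).const_mul (2 : ℂ)
  have i2 := (((UU_us hγ ℓ m).ud.smul hb).int volume t).const_mul (2 : ℂ)
  simp only [JJ]
  have i01 : Integrable (fun q => b q • DD (e1 ℓ) (DD (e1 m) (RR γ t)) q
      - 2 * b q • UU γ m ℓ t q) volume := i0.sub i1
  rw [← integral_const_mul, ← integral_const_mul, ← integral_sub i0 i1,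
    ← integral_sub i01 i2]
  refine integral_congr_ae (Filter.Eventually.of_forall fun q => ?_)
  simp only [TT_eq hγ, real_smul]
  ring

lemma JJ_swap (hγ : GPSolution d lam γ) {a : Ed d × Ed d → ℝ} (ha : PG a) (ℓ m : Fin d) (t : ℝ) :
    JJ (DD (e1 m) (DD (e1 ℓ) a)) (DD (e1 ℓ) (DD (e1 m) (RR γ t)))
      = JJ (DD (e1 ℓ) (DD (e1 ℓ) a)) (DD (e1 m) (DD (e1 m) (RR γ t))) := by
  have hr := (RR_us hγ).DD (e1 m)
  rw [JJ_ibp hr ((ha.DD _).DD _) _ t, JJ_ibp hr ((ha.DD _).DD _) _ t,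
    DD_comm (ha.sm.DD _) (e1 ℓ) (e1 m)]

lemma main_id (hγ : GPSolution d lam γ) {a : Ed d × Ed d → ℝ} (ha : PG a) (t : ℝ) :
    ∑ ℓ, JJ (DD (e1 ℓ) a) (dP lam γ ℓ t)
      = -(1 / 2) * (∑ ℓ, ∑ m, JJ (DD (e1 ℓ) (DD (e1 ℓ) a)) (DD (e1 m) (DD (e1 m) (RR γ t))))
        + (lam / 2) * (∑ ℓ, JJ (DD (e1 ℓ) (DD (e1 ℓ) a)) (HH γ t))
        + 2 * (∑ j, ∑ ℓ, JJ (DD (e1 j) (DD (e1 ℓ) a)) (UU γ j ℓ t))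
        + 2 * (∑ j, ∑ ℓ, (-(1 / 4)) * JJ (DD (e1 j) (DD (e2 ℓ) a)) (TT γ 1 j ℓ t)) := by
  have k1 : ∀ ℓ, JJ (DD (e1 ℓ) a) (dP lam γ ℓ t) =
      -(1 / 2) * (∑ m, JJ (DD (e1 ℓ) (DD (e1 ℓ) a)) (DD (e1 m) (DD (e1 m) (RR γ t))))
      + (lam / 2) * JJ (DD (e1 ℓ) (DD (e1 ℓ) a)) (HH γ t)
      + (∑ m, JJ (DD (e1 m) (DD (e1 ℓ) a)) (UU γ m ℓ t))
      + (∑ m, JJ (DD (e1 ℓ) (DD (e1 m) a)) (UU γ ℓ m t))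
      + 2 * (∑ m, (-(1 / 4)) * JJ (DD (e1 ℓ) (DD (e2 m) a)) (TT γ 1 ℓ m t)) := by
    intro ℓ
    have hb := ha.DD (e1 ℓ)
    have r0 : ∀ m, JJ (DD (e1 ℓ) a) (DD (e1 m) (TT γ 0 ℓ m t)) =
        - JJ (DD (e1 ℓ) (DD (e1 ℓ) a)) (DD (e1 m) (DD (e1 m) (RR γ t)))
        + 2 * JJ (DD (e1 m) (DD (e1 ℓ) a)) (UU γ m ℓ t)
        + 2 * JJ (DD (e1 ℓ) (DD (e1 m) a)) (UU γ ℓ m t) := by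
      intro m
      rw [JJ_ibp (TT_us hγ 0 ℓ m) hb, JJ_TT hγ (hb.DD _), JJ_swap hγ ha,
        DD_comm ha.sm (e1 ℓ) (e1 m)]
      ring
    have r1 : ∀ m, JJ (DD (e1 ℓ) a) (DD (e2 m) (TT γ 1 ℓ m t)) =
        - JJ (DD (e1 ℓ) (DD (e2 m) a)) (TT γ 1 ℓ m t) := by
      intro m
      rw [JJ_ibp (TT_us hγ 1 ℓ m) hb, DD_comm ha.sm (e1 ℓ) (e2 m)]
    rw [JJ_dP hγ hb, JJ_ibp (HH_us hγ) hb]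
    simp only [r0, r1, Finset.sum_add_distrib, Finset.sum_neg_distrib, ← Finset.mul_sum]
    ring
  simp only [k1, Finset.sum_add_distrib, ← Finset.mul_sum]
  rw [Finset.sum_comm (f := fun ℓ m => JJ (DD (e1 m) (DD (e1 ℓ) a)) (UU γ m ℓ t))]
  ring

lemma action_deriv (hγ : GPSolution d lam γ) {a : Ed d × Ed d → ℝ} (ha : PG a) (t : ℝ) :
    deriv (fun s => ∫ x : Ed d, ∫ y : Ed d,
        ∑ ℓ, pdx ℓ a (x, y) * (Pmom2 (γ 2 s) ℓ x y).re) t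
      = (∑ ℓ, JJ (DD (e1 ℓ) a) (dP lam γ ℓ t)).re := by
  have u : UD (fun s q => ∑ ℓ, DD (e1 ℓ) a q • PP γ ℓ s q) :=
    UD.sum _ fun ℓ => (PP_ud hγ ℓ).smul (ha.DD _)
  have u' : UD (fun s q => ∑ ℓ, DD (e1 ℓ) a q • dP lam γ ℓ s q) :=
    UD.sum _ fun ℓ => (dP_ud hγ ℓ).smul (ha.DD _)
  have h0 : (fun s => ∫ x : Ed d, ∫ y : Ed d,
        ∑ ℓ, pdx ℓ a (x, y) * (Pmom2 (γ 2 s) ℓ x y).re)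
      = fun s => (∫ q, ∑ ℓ, DD (e1 ℓ) a q • PP γ ℓ s q).re := by
    funext s
    rw [← fubRe (u.int volume s)]
    simp only [T1 hγ, re_sum, real_smul, re_ofReal_mul]
    rfl
  rw [h0]
  have h1 := u.deriv_int volume u' (fun s q => HasDerivAt.fun_sum fun ℓ _ =>
    (dP_deriv hγ ℓ s q).const_smul (DD (e1 ℓ) a q)) t
  rw [← JJ_sum _ (fun ℓ => dP_ud hγ ℓ) (fun ℓ => ha.DD (e1 ℓ))]
  exact (reCLM.hasFDerivAt.comp_hasDerivAt t h1).deriv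

end Spec

/-- Interaction Morawetz identity for the cubic GP hierarchy. -/
theorem statement_15 (d : ℕ) (hd : 1 ≤ d) (lam : ℝ)
    (γ : (k : ℕ) → ℝ → (Fin k → Ed d) → (Fin k → Ed d) → ℂ)
    (hγ : GPSolution d lam γ)
    (a : Ed d × Ed d → ℝ) (ha : ContDiff ℝ (⊤ : ℕ∞) a)
    (hpoly : ∀ k : ℕ, ∃ C : ℝ, ∃ m : ℕ, ∀ q : Ed d × Ed d,
        ‖iteratedFDeriv ℝ k a q‖ ≤ C * (1 + ‖q‖) ^ m)
    (t : ℝ) :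
    deriv (fun s => ∫ x : Ed d, ∫ y : Ed d,
        ∑ ℓ, pdx ℓ a (x, y) * (Pmom2 (γ 2 s) ℓ x y).re) t
      = -(1 / 2) * (∫ x : Ed d, ∫ y : Ed d, lapX a (x, y) *
            (∑ ℓ, fderiv ℝ (fun z => fderiv ℝ (fun w => γ 2 t ![w, y] ![w, y]) z
                (EuclideanSpace.single ℓ 1)) x (EuclideanSpace.single ℓ 1)).re)
        + (lam / 2) * (∫ x : Ed d, ∫ y : Ed d, lapX a (x, y) *
            (γ 3 t ![x, y, x] ![x, y, x]).re)
        + 2 * (∫ x : Ed d, ∫ y : Ed d, ∑ j, ∑ ℓ,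
            ((pdx j (pdx ℓ a) (x, y) : ℝ) : ℂ) *
              fderiv ℝ (fun z' => fderiv ℝ (fun z => γ 2 t ![z, y] ![z', y]) x
                  (EuclideanSpace.single ℓ 1)) x (EuclideanSpace.single j 1)).re
        + 2 * (∫ x : Ed d, ∫ y : Ed d, ∑ j, ∑ ℓ,
            pdx j (pdy ℓ a) (x, y) * (Qcorr (γ 2 t) j ℓ x y).re) := by

  have hA : PG a := ⟨ha, hpoly⟩
  rw [action_deriv hγ hA t, main_id hγ hA t]
  have q1 : (∫ x : Ed d, ∫ y : Ed d, lapX a (x, y) *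
            (∑ ℓ, fderiv ℝ (fun z => fderiv ℝ (fun w => γ 2 t ![w, y] ![w, y]) z
                (EuclideanSpace.single ℓ 1)) x (EuclideanSpace.single ℓ 1)).re)
      = (∑ ℓ, ∑ m, JJ (DD (e1 ℓ) (DD (e1 ℓ) a)) (DD (e1 m) (DD (e1 m) (RR γ t)))).re := by
    have u : ∀ ℓ : Fin d, UD (fun s q => ∑ m, DD (e1 ℓ) (DD (e1 ℓ) a) q •
        DD (e1 m) (DD (e1 m) (RR γ s)) q) := fun ℓ =>
      UD.sum _ fun m => (((RR_us hγ).DD (e1 m)).DD (e1 m)).ud.smul ((hA.DD _).DD _)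
    have e : ∑ ℓ, ∑ m, JJ (DD (e1 ℓ) (DD (e1 ℓ) a)) (DD (e1 m) (DD (e1 m) (RR γ t)))
        = ∫ q, ∑ ℓ, ∑ m, DD (e1 ℓ) (DD (e1 ℓ) a) q • DD (e1 m) (DD (e1 m) (RR γ t)) q := by
      rw [integral_finsetSum _ fun ℓ _ => (u ℓ).int volume t]
      refine Finset.sum_congr rfl fun ℓ _ => ?_
      exact (JJ_sum _ (fun m => (((RR_us hγ).DD (e1 m)).DD (e1 m)).ud)
        (fun _ => (hA.DD _).DD _) t).symm
    rw [e, ← fubRe ((UD.sum Finset.univ u).int volume t)]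
    simp only [T3 hγ]
    congr 1
    funext x
    congr 1
    funext y
    rw [← re_ofReal_mul]
    simp only [lapX, real_smul, ← Finset.mul_sum, ← Finset.sum_mul, ofReal_sum]
    rfl
  have q2 : (∫ x : Ed d, ∫ y : Ed d, lapX a (x, y) * (γ 3 t ![x, y, x] ![x, y, x]).re)
      = (∑ ℓ, JJ (DD (e1 ℓ) (DD (e1 ℓ) a)) (HH γ t)).re := by
    have u : UD (fun s q => ∑ ℓ, DD (e1 ℓ) (DD (e1 ℓ) a) q • HH γ s q) :=
      UD.sum _ fun m => (HH_us hγ).ud.smul ((hA.DD _).DD _)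
    rw [← JJ_sum _ (fun _ => (HH_us hγ).ud) (fun ℓ => (hA.DD (e1 ℓ)).DD (e1 ℓ)),
      ← fubRe (u.int volume t)]
    congr 1
    funext x
    congr 1
    funext y
    rw [← re_ofReal_mul]
    simp only [lapX, real_smul, ← Finset.mul_sum, ← Finset.sum_mul, ofReal_sum]
    rfl
  have q3 : (∫ x : Ed d, ∫ y : Ed d, ∑ j, ∑ ℓ,
            ((pdx j (pdx ℓ a) (x, y) : ℝ) : ℂ) *
              fderiv ℝ (fun z' => fderiv ℝ (fun z => γ 2 t ![z, y] ![z', y]) x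
                  (EuclideanSpace.single ℓ 1)) x (EuclideanSpace.single j 1))
      = ∑ j, ∑ ℓ, JJ (DD (e1 j) (DD (e1 ℓ) a)) (UU γ j ℓ t) := by
    have u : ∀ j : Fin d, UD (fun s q => ∑ ℓ, DD (e1 j) (DD (e1 ℓ) a) q •
        UU γ j ℓ s q) := fun j =>
      UD.sum _ fun ℓ => (UU_us hγ j ℓ).ud.smul ((hA.DD _).DD _)
    have e : ∑ j, ∑ ℓ, JJ (DD (e1 j) (DD (e1 ℓ) a)) (UU γ j ℓ t)
        = ∫ q, ∑ j, ∑ ℓ, DD (e1 j) (DD (e1 ℓ) a) q • UU γ j ℓ t q := by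
      rw [integral_finsetSum _ fun ℓ _ => (u ℓ).int volume t]
      refine Finset.sum_congr rfl fun j _ => ?_
      exact (JJ_sum _ (fun ℓ => (UU_us hγ j ℓ).ud) (fun _ => (hA.DD _).DD _) t).symm
    rw [e, ← fub ((UD.sum Finset.univ u).int volume t)]
    simp only [T5 hγ, real_smul]
    rfl
  have q4 : (∫ x : Ed d, ∫ y : Ed d, ∑ j, ∑ ℓ,
            pdx j (pdy ℓ a) (x, y) * (Qcorr (γ 2 t) j ℓ x y).re)
      = (∑ j, ∑ ℓ, (-(1 / 4)) * JJ (DD (e1 j) (DD (e2 ℓ) a)) (TT γ 1 j ℓ t)).re := by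
    have u0 : ∀ j ℓ : Fin d, UD (fun s q => (-(1 / 4) : ℂ) * TT γ 1 j ℓ s q) := fun j ℓ =>
      (TT_us hγ 1 j ℓ).ud.cmul _
    have u : ∀ j : Fin d, UD (fun s q => ∑ ℓ, DD (e1 j) (DD (e2 ℓ) a) q •
        ((-(1 / 4) : ℂ) * TT γ 1 j ℓ s q)) := fun j =>
      UD.sum _ fun ℓ => (u0 j ℓ).smul ((hA.DD _).DD _)
    have e : ∑ j, ∑ ℓ, (-(1 / 4)) * JJ (DD (e1 j) (DD (e2 ℓ) a)) (TT γ 1 j ℓ t)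
        = ∫ q, ∑ j, ∑ ℓ, DD (e1 j) (DD (e2 ℓ) a) q • ((-(1 / 4) : ℂ) * TT γ 1 j ℓ t q) := by
      rw [integral_finsetSum _ fun ℓ _ => (u ℓ).int volume t]
      refine Finset.sum_congr rfl fun j _ => ?_
      rw [JJ_sum _ (fun ℓ => u0 j ℓ) (fun _ => (hA.DD _).DD _) t]
      refine Finset.sum_congr rfl fun ℓ _ => ?_
      simp only [JJ]
      rw [← integral_const_mul]
      congr 1
      funext q
      simp only [real_smul]
      ring
    rw [e, ← fubRe ((UD.sum Finset.univ u).int volume t)]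
    simp only [T2 hγ, re_sum, real_smul, re_ofReal_mul]
    rfl
  rw [q1, q2, q3, q4]
  have hre : ∀ (r : ℝ) (z : ℂ), ((r : ℂ) * z).re = r * z.re := re_ofReal_mul
  have c1 : (-(1 / 2) : ℂ) = ((-(1 / 2) : ℝ) : ℂ) := by push_cast; rfl
  have c2 : ((lam : ℂ) / 2) = ((lam / 2 : ℝ) : ℂ) := by push_cast; rfl
  have c3 : (2 : ℂ) = ((2 : ℝ) : ℂ) := by push_cast; rfl
  rw [add_re, add_re, add_re, c1, c2, hre, hre]
  congr 1
  · congr 1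
    rw [c3, hre]
  · rw [c3, hre]
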